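/- For all natural numbers n, m ≥ 1 with n ≠ m: A_n ≽ A_m if and only if n divides m; B_n ≽ B_m if and only if n divides m; and C_n ≽ C_m if and only if n divides m. -/

import Mathlib

open FirstOrder Language

/-- Language with relation symbols indexed by `ι`, where symbol `i` has arity `ar i`. -/
def multiRelLang {ι : Type} (ar : ι → ℕ) : FirstOrder.Language where
  Functions _ := Empty
  Relations m := { i : ι // ar i = m }

/-- The structure on `M` interpreting symbol `i` as the relation `Rels i`. -/
def multiRelStructure {M : Type*} {ι : Type} {ar : ι → ℕ}
    (Rels : ∀ i, (Fin (ar i) → M) → Prop) : (multiRelLang ar).Structure M where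
  funMap f := f.elim
  RelMap r x := Rels r.1 fun j => x (Fin.cast r.2 j)

/-- Language with one relation symbol, of arity `n`. -/
def relLang (n : ℕ) : FirstOrder.Language := multiRelLang (fun _ : Unit => n)

/-- `R` is definable, without parameters, by a first-order formula in the language with a
single relation symbol interpreted as `Q`. -/
def DefinableBy {M : Type*} {n k : ℕ} (Q : (Fin n → M) → Prop)
    (R : (Fin k → M) → Prop) : Prop :=
  letI : (relLang n).Structure M := multiRelStructure (fun _ : Unit => Q)
  ∃ φ : (relLang n).Formula (Fin k), ∀ v : Fin k → M, R v ↔ φ.Realize v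

/-- The successor relation on `ℤ` : `v 1 = v 0 + 1`. -/
def succZ : (Fin 2 → ℤ) → Prop := fun v => v 1 = v 0 + 1

/-- The binary relation `A_n` : `x₁ − x₂ = n` on `ℤ`. -/
def AZ (n : ℕ) : (Fin 2 → ℤ) → Prop := fun v => v 0 - v 1 = (n : ℤ)

/-- The 4-ary relation `B_n` :
`(x₁ − x₂ = n ∧ x₃ − x₄ = n) ∨ (x₁ − x₂ = −n ∧ x₃ − x₄ = −n)` on `ℤ`. -/
def BZ (n : ℕ) : (Fin 4 → ℤ) → Prop := fun v =>
  (v 0 - v 1 = (n : ℤ) ∧ v 2 - v 3 = (n : ℤ)) ∨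
  (v 0 - v 1 = -(n : ℤ) ∧ v 2 - v 3 = -(n : ℤ))

/-- The binary relation `C_n` : `|x₁ − x₂| = n` on `ℤ`. -/
def CZ (n : ℕ) : (Fin 2 → ℤ) → Prop := fun v => |v 0 - v 1| = (n : ℤ)

/-- `Q ≈ R` : the relations `Q` and `R` define each other. -/
def DefEquiv {M : Type*} {n k : ℕ} (Q : (Fin n → M) → Prop)
    (R : (Fin k → M) → Prop) : Prop :=
  DefinableBy Q R ∧ DefinableBy R Q

section Definability

variable {M : Type*} {n : ℕ}

/-- Definability by a first-order formula in the language of the single relation `Q`, for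
relations whose arguments are indexed by an arbitrary type. -/
def PredDefinableBy {α : Type} (Q : (Fin n → M) → Prop) (P : (α → M) → Prop) : Prop :=
  letI : (relLang n).Structure M := multiRelStructure (fun _ : Unit => Q)
  ∃ φ : (relLang n).Formula α, ∀ v : α → M, P v ↔ φ.Realize v

variable {α : Type} {Q : (Fin n → M) → Prop}

theorem PredDefinableBy.rel (f : Fin n → α) :
    PredDefinableBy Q fun v : α → M => Q fun j => v (f j) := by
  let _ : (relLang n).Structure M := multiRelStructure (fun _ : Unit => Q)
  let R : (relLang n).Relations n := ⟨(), rfl⟩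
  refine ⟨R.formula fun j => Term.var (f j), fun v => Iff.symm ?_⟩
  exact Formula.realize_rel

theorem PredDefinableBy.eq (a b : α) : PredDefinableBy Q fun v : α → M => v a = v b := by
  let _ : (relLang n).Structure M := multiRelStructure (fun _ : Unit => Q)
  refine ⟨Term.equal (Term.var a) (Term.var b), fun v => Iff.symm ?_⟩
  exact Formula.realize_equal

theorem PredDefinableBy.not {P : (α → M) → Prop} (hP : PredDefinableBy Q P) :
    PredDefinableBy Q fun v => ¬ P v := by
  let _ : (relLang n).Structure M := multiRelStructure (fun _ : Unit => Q)
  obtain ⟨φ, hφ⟩ := hP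
  exact ⟨φ.not, fun v => (hφ v).not.trans Formula.realize_not.symm⟩

theorem PredDefinableBy.and {P P' : (α → M) → Prop} (hP : PredDefinableBy Q P)
    (hP' : PredDefinableBy Q P') : PredDefinableBy Q fun v => P v ∧ P' v := by
  let _ : (relLang n).Structure M := multiRelStructure (fun _ : Unit => Q)
  obtain ⟨φ, hφ⟩ := hP
  obtain ⟨ψ, hψ⟩ := hP'
  exact ⟨φ ⊓ ψ, fun v => ((hφ v).and (hψ v)).trans Formula.realize_inf.symm⟩

theorem PredDefinableBy.forall {β : Type} [Finite β] {P : β → (α → M) → Prop}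
    (hP : ∀ b, PredDefinableBy Q (P b)) : PredDefinableBy Q fun v => ∀ b, P b v := by
  let _ : (relLang n).Structure M := multiRelStructure (fun _ : Unit => Q)
  choose φ hφ using hP
  exact ⟨Formula.iInf φ, fun v =>
    (forall_congr' fun b => hφ b v).trans Formula.realize_iInf.symm⟩

theorem PredDefinableBy.exists {β : Type} [Finite β] {P : (α ⊕ β → M) → Prop}
    (hP : PredDefinableBy Q P) : PredDefinableBy Q fun v => ∃ u : β → M, P (Sum.elim v u) := by
  let _ : (relLang n).Structure M := multiRelStructure (fun _ : Unit => Q)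
  obtain ⟨φ, hφ⟩ := hP
  exact ⟨Formula.iExs β φ, fun v =>
    (exists_congr fun u => hφ (Sum.elim v u)).trans Formula.realize_iExs.symm⟩

theorem DefinableBy.of_pred {k : ℕ} {R P : (Fin k → M) → Prop} (hP : PredDefinableBy Q P)
    (h : ∀ v, R v ↔ P v) : DefinableBy Q R := by
  obtain ⟨φ, hφ⟩ := hP
  exact ⟨φ, fun v => (h v).trans (hφ v)⟩

/-- A definable relation is invariant under the automorphisms of the defining relation. -/
theorem DefinableBy.invariant {k : ℕ} {R : (Fin k → M) → Prop} (h : DefinableBy Q R)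
    (e : M ≃ M) (he : ∀ v, Q (e ∘ v) ↔ Q v) (v : Fin k → M) : R (e ∘ v) ↔ R v := by
  let _ : (relLang n).Structure M := multiRelStructure (fun _ : Unit => Q)
  obtain ⟨φ, hφ⟩ := h
  let E : (relLang n).Equiv M M :=
    { toEquiv := e
      map_fun' := fun f => f.elim
      map_rel' := fun r x => he fun j => x (Fin.cast r.2 j) }
  rw [hφ, hφ]
  exact StrongHomClass.realize_formula E φ

end Definability

section Chains

theorem sub_eq_mul_of_steps {u : ℕ → ℤ} {d : ℤ} {k : ℕ} (h : ∀ i < k, u i - u (i + 1) = d) :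
    u 0 - u k = k * d := by
  induction k with
  | zero => simp
  | succ k ih =>
    have h₁ := ih fun i hi => h i (by omega)
    have h₂ := h k (by omega)
    push_cast
    linarith

theorem step_eq_of_abs {u : ℕ → ℤ} {d : ℤ} {k : ℕ} (h : ∀ i < k, |u i - u (i + 1)| = d)
    (h' : ∀ i, i + 1 < k → u i ≠ u (i + 2)) : ∀ i < k, u i - u (i + 1) = u 0 - u 1 := by
  intro i
  induction i with
  | zero => intro _; rfl
  | succ i ih =>
    intro hi
    have h₁ := ih (by omega)
    have h₂ := h i (by omega)
    have h₃ := h (i + 1) hi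
    have h₄ := h' i hi
    rw [show i + 1 + 1 = i + 2 from rfl] at *
    rcases abs_choice (u i - u (i + 1)) with h₅ | h₅ <;>
    rcases abs_choice (u (i + 1) - u (i + 2)) with h₆ | h₆ <;> omega

theorem val_ofNat_of_le {k i : ℕ} (hi : i ≤ k) : (Fin.ofNat (k + 1) i).val = i :=
  Nat.mod_eq_of_lt (Nat.lt_succ_of_le hi)

end Chains

theorem AZ_definableBy_mul (n k : ℕ) : DefinableBy (AZ n) (AZ (n * k)) := by
  let p (i : ℕ) : Fin 2 ⊕ Fin (k + 1) := Sum.inr (Fin.ofNat (k + 1) i)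
  refine DefinableBy.of_pred (PredDefinableBy.exists
    (((PredDefinableBy.eq (Sum.inl 0) (p 0)).and (PredDefinableBy.eq (Sum.inl 1) (p k))).and
      (PredDefinableBy.forall fun i : Fin k => PredDefinableBy.rel ![p i, p (i + 1)]))) fun v => ?_
  simp only [AZ, p, Sum.elim_inl, Sum.elim_inr, Matrix.cons_val_zero, Matrix.cons_val_one,
    Fin.forall_iff]
  constructor
  · intro h
    refine ⟨fun j => v 0 - j.val * n, ⟨?_, ?_⟩, fun i hi => ?_⟩
    · dsimp only
      rw [val_ofNat_of_le (Nat.zero_le k)]; simp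
    · dsimp only
      rw [val_ofNat_of_le le_rfl]; push_cast at h; linarith
    · dsimp only
      rw [val_ofNat_of_le hi.le, val_ofNat_of_le (Nat.succ_le_of_lt hi)]; push_cast; ring
  · rintro ⟨u, ⟨h₀, h₁⟩, h⟩
    have := sub_eq_mul_of_steps (u := fun i => u (Fin.ofNat (k + 1) i)) h
    rw [h₀, h₁, this]; push_cast; ring

theorem CZ_definableBy_mul (n k : ℕ) (hn : 1 ≤ n) (hk : 1 ≤ k) :
    DefinableBy (CZ n) (CZ (n * k)) := by
  let p (i : ℕ) : Fin 2 ⊕ Fin (k + 1) := Sum.inr (Fin.ofNat (k + 1) i)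
  refine DefinableBy.of_pred (PredDefinableBy.exists
    (((PredDefinableBy.eq (Sum.inl 0) (p 0)).and (PredDefinableBy.eq (Sum.inl 1) (p k))).and
      ((PredDefinableBy.forall fun i : Fin k => PredDefinableBy.rel ![p i, p (i + 1)]).and
      (PredDefinableBy.forall fun i : Fin (k - 1) =>
        (PredDefinableBy.eq (p i) (p (i + 2))).not)))) fun v => ?_
  simp only [CZ, p, Sum.elim_inl, Sum.elim_inr, Matrix.cons_val_zero, Matrix.cons_val_one,
    Fin.forall_iff]
  constructor
  · intro h
    obtain ⟨d, hd, hv⟩ : ∃ d : ℤ, |d| = n ∧ v 0 - v 1 = k * d := by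
      push_cast at h
      rcases abs_choice (v 0 - v 1) with h' | h'
      · exact ⟨n, by simp, by linarith⟩
      · exact ⟨-n, by simp, by linarith⟩
    have hd₀ : d ≠ 0 := by rintro rfl; simp at hd; omega
    refine ⟨fun j => v 0 - j.val * d, ⟨?_, ?_⟩, fun i hi => ?_, fun i hi => ?_⟩
    · dsimp only
      rw [val_ofNat_of_le (Nat.zero_le k)]; simp
    · dsimp only
      rw [val_ofNat_of_le le_rfl]; linarith
    · dsimp only
      rw [val_ofNat_of_le hi.le, val_ofNat_of_le (Nat.succ_le_of_lt hi), ← hd]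
      congr 1; push_cast; ring
    · dsimp only
      rw [val_ofNat_of_le (by omega), val_ofNat_of_le (by omega)]
      intro h'
      push_cast at h'
      exact hd₀ (by linarith)
  · rintro ⟨u, ⟨h₀, h₁⟩, h, h'⟩
    have hs := step_eq_of_abs (u := fun i => u (Fin.ofNat (k + 1) i)) h
      fun i hi => h' i (by omega)
    have := sub_eq_mul_of_steps hs
    have h₂ := h 0 hk
    simp only [zero_add] at h₂
    rw [h₀, h₁, this, abs_mul, h₂]; push_cast; simp [mul_comm]

theorem BZ_definableBy_mul (n k : ℕ) (hn : 1 ≤ n) (hk : 1 ≤ k) :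
    DefinableBy (BZ n) (BZ (n * k)) := by
  let p (i : ℕ) : Fin 4 ⊕ (Fin (k + 1) ⊕ Fin (k + 1)) := Sum.inr (Sum.inl (Fin.ofNat (k + 1) i))
  let q (i : ℕ) : Fin 4 ⊕ (Fin (k + 1) ⊕ Fin (k + 1)) := Sum.inr (Sum.inr (Fin.ofNat (k + 1) i))
  refine DefinableBy.of_pred (PredDefinableBy.exists
    (((PredDefinableBy.eq (Sum.inl 0) (p 0)).and (PredDefinableBy.eq (Sum.inl 1) (p k))).and
      (((PredDefinableBy.eq (Sum.inl 2) (q 0)).and (PredDefinableBy.eq (Sum.inl 3) (q k))).and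
      (PredDefinableBy.forall fun i : Fin k => PredDefinableBy.forall fun j : Fin k =>
        PredDefinableBy.rel ![p i, p (i + 1), q j, q (j + 1)])))) fun v => ?_
  simp only [BZ, p, q, Sum.elim_inl, Sum.elim_inr, Matrix.cons_val, Fin.forall_iff]
  constructor
  · intro h
    obtain ⟨d, hd, hv, hw⟩ :
        ∃ d : ℤ, (d = n ∨ d = -n) ∧ v 0 - v 1 = k * d ∧ v 2 - v 3 = k * d := by
      push_cast at h
      rcases h with ⟨h, h'⟩ | ⟨h, h'⟩
      · exact ⟨n, by simp, by linarith, by linarith⟩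
      · exact ⟨-n, by simp, by linarith, by linarith⟩
    refine ⟨Sum.elim (fun j => v 0 - j.val * d) (fun j => v 2 - j.val * d), ⟨?_, ?_⟩, ⟨?_, ?_⟩,
      fun i hi j hj => ?_⟩
    · dsimp only [Sum.elim_inl, Sum.elim_inr]
      rw [val_ofNat_of_le (Nat.zero_le k)]; simp
    · dsimp only [Sum.elim_inl, Sum.elim_inr]
      rw [val_ofNat_of_le le_rfl]; linarith
    · dsimp only [Sum.elim_inl, Sum.elim_inr]
      rw [val_ofNat_of_le (Nat.zero_le k)]; simp
    · dsimp only [Sum.elim_inl, Sum.elim_inr]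
      rw [val_ofNat_of_le le_rfl]; linarith
    · dsimp only [Sum.elim_inl, Sum.elim_inr]
      rw [val_ofNat_of_le hi.le, val_ofNat_of_le (Nat.succ_le_of_lt hi),
        val_ofNat_of_le hj.le, val_ofNat_of_le (Nat.succ_le_of_lt hj)]
      refine hd.imp (fun h => ?_) fun h => ?_ <;>
      · subst h
        constructor <;> (push_cast; ring)
  · rintro ⟨u, ⟨h₀, h₁⟩, ⟨h₂, h₃⟩, h⟩
    rw [h₀, h₁, h₂, h₃]
    have key : ∀ d : ℤ, (∀ i < k, u (Sum.inl (Fin.ofNat (k + 1) i)) -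
          u (Sum.inl (Fin.ofNat (k + 1) (i + 1))) = d) →
        (∀ i < k, u (Sum.inr (Fin.ofNat (k + 1) i)) -
          u (Sum.inr (Fin.ofNat (k + 1) (i + 1))) = d) →
        u (Sum.inl (Fin.ofNat (k + 1) 0)) - u (Sum.inl (Fin.ofNat (k + 1) k)) = k * d ∧
        u (Sum.inr (Fin.ofNat (k + 1) 0)) - u (Sum.inr (Fin.ofNat (k + 1) k)) = k * d :=
      fun d hp hq => ⟨sub_eq_mul_of_steps (u := fun i => u (Sum.inl (Fin.ofNat (k + 1) i))) hp,
        sub_eq_mul_of_steps (u := fun i => u (Sum.inr (Fin.ofNat (k + 1) i))) hq⟩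
    have hn' : (n : ℤ) ≠ -n := by omega
    rcases h 0 hk 0 hk with ⟨ha, hb⟩ | ⟨ha, hb⟩
    · have := key n (fun i hi => by have := h i hi 0 hk; omega)
        (fun i hi => by have := h 0 hk i hi; omega)
      left; push_cast; constructor <;> linarith
    · have := key (-n) (fun i hi => by have := h i hi 0 hk; omega)
        (fun i hi => by have := h 0 hk i hi; omega)
      right; push_cast; constructor <;> linarith

section Shift

/-- The permutation of `ℤ` shifting the multiples of `n` by `2 * n` and fixing all other
integers. -/
def shiftMultiples (n : ℕ) : ℤ ≃ ℤ where
  toFun x := if (n : ℤ) ∣ x then x + 2 * n else x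
  invFun x := if (n : ℤ) ∣ x then x - 2 * n else x
  left_inv x := by
    by_cases h : (n : ℤ) ∣ x
    · simp [h, (dvd_add_left (Dvd.intro_left 2 rfl : (n : ℤ) ∣ 2 * n)).2 h]
    · simp [h]
  right_inv x := by
    by_cases h : (n : ℤ) ∣ x
    · simp [h, dvd_sub h (Dvd.intro_left 2 rfl : (n : ℤ) ∣ 2 * n)]
    · simp [h]

theorem shiftMultiples_apply (n : ℕ) (x : ℤ) :
    shiftMultiples n x = if (n : ℤ) ∣ x then x + 2 * n else x := rfl

theorem shiftMultiples_sub_eq_iff (n : ℕ) {d : ℤ} (hd : (n : ℤ) ∣ d) (x y : ℤ) :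
    shiftMultiples n x - shiftMultiples n y = d ↔ x - y = d := by
  have h2 : (n : ℤ) ∣ 2 * n := Dvd.intro_left 2 rfl
  have key : (n : ℤ) ∣ x - y → ((n : ℤ) ∣ x ↔ (n : ℤ) ∣ y) := fun h => by
    simpa using dvd_add_right (b := x - y) (c := y) h
  simp only [shiftMultiples_apply]
  constructor
  · intro h
    have hxy : (n : ℤ) ∣ x - y := by
      rw [← h] at hd
      split_ifs at hd
      · simpa using hd
      · exact (by ring : x + 2 * (n : ℤ) - y - 2 * n = x - y) ▸ dvd_sub hd h2
      · exact (by ring : x - (y + 2 * (n : ℤ)) + 2 * n = x - y) ▸ dvd_add hd h2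
      · exact hd
    have := key hxy
    split_ifs at h <;> first | tauto | linarith
  · intro h
    have := key (h ▸ hd)
    split_ifs <;> first | tauto | linarith

theorem AZ_shiftMultiples (n : ℕ) (v : Fin 2 → ℤ) : AZ n (shiftMultiples n ∘ v) ↔ AZ n v :=
  shiftMultiples_sub_eq_iff n dvd_rfl _ _

theorem BZ_shiftMultiples (n : ℕ) (v : Fin 4 → ℤ) : BZ n (shiftMultiples n ∘ v) ↔ BZ n v := by
  have h : (n : ℤ) ∣ -n := (dvd_neg).2 dvd_rfl
  simp only [BZ, Function.comp_apply, shiftMultiples_sub_eq_iff n dvd_rfl,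
    shiftMultiples_sub_eq_iff n h]

theorem CZ_shiftMultiples (n : ℕ) (v : Fin 2 → ℤ) : CZ n (shiftMultiples n ∘ v) ↔ CZ n v := by
  have h : (n : ℤ) ∣ -n := (dvd_neg).2 dvd_rfl
  simp only [CZ, Function.comp_apply, abs_eq (Int.natCast_nonneg n),
    shiftMultiples_sub_eq_iff n dvd_rfl, shiftMultiples_sub_eq_iff n h]

end Shift

/-- For `n, m ≥ 1` with `n ≠ m` : each of `A_n ≽ A_m`, `B_n ≽ B_m`, `C_n ≽ C_m` holds
iff `n` divides `m`. -/
theorem A_B_C_divisibility (n m : ℕ) (hn : 1 ≤ n) (hm : 1 ≤ m) (hnm : n ≠ m) :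
    (DefinableBy (AZ n) (AZ m) ↔ n ∣ m) ∧
    (DefinableBy (BZ n) (BZ m) ↔ n ∣ m) ∧
    (DefinableBy (CZ n) (CZ m) ↔ n ∣ m) := by
  have hshift : ¬ n ∣ m → shiftMultiples n m = m ∧ shiftMultiples n 0 = 2 * n := fun h => by
    simp [shiftMultiples_apply, Int.natCast_dvd_natCast, h]
  refine ⟨⟨fun h => ?_, ?_⟩, ⟨fun h => ?_, ?_⟩, ⟨fun h => ?_, ?_⟩⟩
  · by_contra hd
    have := (h.invariant (shiftMultiples n) (AZ_shiftMultiples n) ![(m : ℤ), 0]).2 (by simp [AZ])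
    simp [AZ, hshift hd] at this
    omega
  · rintro ⟨k, rfl⟩
    exact AZ_definableBy_mul n k
  · by_contra hd
    have := (h.invariant (shiftMultiples n) (BZ_shiftMultiples n) ![(m : ℤ), 0, m, 0]).2
      (by simp [BZ])
    simp [BZ, hshift hd] at this
    omega
  · rintro ⟨k, rfl⟩
    exact BZ_definableBy_mul n k hn (Nat.pos_of_mul_pos_left hm)
  · by_contra hd
    have := (h.invariant (shiftMultiples n) (CZ_shiftMultiples n) ![(m : ℤ), 0]).2 (by simp [CZ])
    simp [CZ, hshift hd, abs_eq] at this
    omega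
  · rintro ⟨k, rfl⟩
    exact CZ_definableBy_mul n k hn (Nat.pos_of_mul_pos_left hm)
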